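/- arXiv:1705.03238 — 3 statements merged into one kernel-verified Lean document; each statement's English description precedes it below -/
import Mathlib

section
/- Let X be a k-complete topologized semilattice, let Z ⊆ X be a closed subsemilattice, and let h : Z → Y be a continuous homomorphism into a Hausdorff topological semigroup Y (i.e., h(a ⊓ b) = h(a)·h(b) for all a, b ∈ Z, where · is the continuous multiplication of Y). Then the image h(Z) is closed in Y. -/
open Set Topology

/-- A topologized semilattice `X` is *k-complete* if every nonempty chain `C ⊆ X` has a
greatest lower bound and a least upper bound, both belonging to the closure of `C`. -/
def KComplete (X : Type*) [SemilatticeInf X] [TopologicalSpace X] : Prop :=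
  ∀ C : Set X, C.Nonempty → IsChain (· ≤ ·) C →
    (∃ a, IsGLB C a ∧ a ∈ closure C) ∧ ∃ b, IsLUB C b ∧ b ∈ closure C

lemma KComplete.exists_sup {X : Type*} [SemilatticeInf X] [TopologicalSpace X]
    (hX : KComplete X) {ι : Type*} [LinearOrder ι] [Nonempty ι] (m : ι → X) (hm : Monotone m)
    (T : ι → Set X) (hT : ∀ i, IsClosed (T i)) (hmT : ∀ i j, i ≤ j → m j ∈ T i) :
    ∃ a, ∀ i, a ∈ T i := by
  have key : ∀ i, ∃ b, IsLUB (range m) b ∧ b ∈ T i := by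
    intro i
    have hch : IsChain (· ≤ ·) (m '' Ici i) := by
      rintro _ ⟨j, _, rfl⟩ _ ⟨k, _, rfl⟩ _
      rcases le_total j k with h | h
      · exact Or.inl (hm h)
      · exact Or.inr (hm h)
    obtain ⟨b, hb, hbc⟩ := (hX (m '' Ici i) ⟨m i, i, le_refl i, rfl⟩ hch).2
    refine ⟨b, ⟨?_, ?_⟩, ?_⟩
    · rintro _ ⟨j, rfl⟩
      exact (hm (le_max_right i j)).trans (hb.1 ⟨max i j, le_max_left i j, rfl⟩)
    · intro c hc
      apply hb.2
      rintro _ ⟨j, _, rfl⟩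
      exact hc ⟨j, rfl⟩
    · refine closure_minimal ?_ (hT i) hbc
      rintro _ ⟨j, hj, rfl⟩
      exact hmT i j hj
  obtain ⟨b, hb, _⟩ := key (Classical.arbitrary ι)
  refine ⟨b, fun i => ?_⟩
  obtain ⟨c, hc, hci⟩ := key i
  exact (hb.unique hc) ▸ hci

lemma KComplete.exists_least {X : Type*} [SemilatticeInf X] [TopologicalSpace X]
    (hX : KComplete X) (S : Set X) (hS : IsClosed S) (hinf : ∀ a ∈ S, ∀ b ∈ S, a ⊓ b ∈ S)
    (hne : S.Nonempty) : ∃ m, IsLeast S m := by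
  obtain ⟨x, hx⟩ := hne
  obtain ⟨m, hm⟩ : ∃ m, Minimal (· ∈ S) m := by
    refine zorn_le₀ (α := Xᵒᵈ) S ?_
    intro C hCS hC
    rcases C.eq_empty_or_nonempty with rfl | hne
    · exact ⟨x, hx, by simp⟩
    · obtain ⟨a, ha, hac⟩ := (hX C hne hC.symm).1
      exact ⟨a, closure_minimal hCS hS hac, fun z hz => ha.1 hz⟩
  refine ⟨m, hm.1, fun z hz => ?_⟩
  exact (hm.2 (hinf m hm.1 z hz) inf_le_left).trans inf_le_right

lemma KComplete.fip {X : Type*} [SemilatticeInf X] [TopologicalSpace X]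
    (hX : KComplete X) (κ : Cardinal) : ∀ (ι : Type _), Cardinal.mk ι = κ → ∀ S : ι → Set X,
    (∀ i, IsClosed (S i)) → (∀ i, ∀ a ∈ S i, ∀ b ∈ S i, a ⊓ b ∈ S i) →
    (∀ t : Finset ι, ∃ a, ∀ i ∈ t, a ∈ S i) → ∃ a, ∀ i, a ∈ S i := by
  induction κ using WellFoundedLT.induction with
  | ind κ ih =>
  intro ι hι S hcl hinf hfip
  rcases finite_or_infinite ι with hfin | hinfi
  · have := Fintype.ofFinite ι
    obtain ⟨a, ha⟩ := hfip Finset.univ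
    exact ⟨a, fun i => ha i (Finset.mem_univ i)⟩
  obtain ⟨r, wo, hr⟩ := Cardinal.exists_ord_eq ι
  classical
  let _ : LinearOrder ι := linearOrderOfSTO r
  have hwf : WellFoundedLT ι := ⟨wo.wf⟩
  have hr' : Cardinal.ord (Cardinal.mk ι) = Ordinal.type (α := ι) (· < ·) := hr
  have hcard : ∀ i : ι, Cardinal.mk (Iio i) < κ := by
    intro i
    rw [← hι]
    exact Cardinal.mk_Iio_lt i hr'
  have hnm : NoMaxOrder ι := by
    rw [← Ordinal.isSuccPrelimit_type_lt_iff, ← hr']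
    exact (Cardinal.isSuccLimit_ord (Cardinal.aleph0_le_mk ι)).isSuccPrelimit
  have hmax : ∀ i : ι, ∃ j, i < j := fun i => exists_gt i
  have hT : ∀ i : ι, ∃ m, IsLeast {a | ∀ j < i, a ∈ S j} m := by
    intro i
    apply hX.exists_least
    · simp only [ofPred_forall]
      exact isClosed_iInter fun j => isClosed_iInter fun _ => hcl j
    · intro a ha b hb j hj
      exact hinf j a (ha j hj) b (hb j hj)
    · obtain ⟨a, ha⟩ := ih _ (hcard i) (Iio i) rfl (fun j => S j) (fun j => hcl j)
        (fun j => hinf j) (by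
          classical
          intro t
          obtain ⟨a, ha⟩ := hfip (t.image Subtype.val)
          exact ⟨a, fun j hj => ha j (Finset.mem_image_of_mem _ hj)⟩)
      exact ⟨a, fun j hj => ha ⟨j, hj⟩⟩
  choose m hm using hT
  obtain ⟨a, ha⟩ := hX.exists_sup m
    (fun i j hij => (hm i).2 fun k hk => (hm j).1 k (lt_of_lt_of_le hk hij))
    (fun i => {a | ∀ j < i, a ∈ S j})
    (fun i => by
      simp only [ofPred_forall]
      exact isClosed_iInter fun j => isClosed_iInter fun _ => hcl j)
    (fun i j hij k hk => (hm j).1 k (lt_of_lt_of_le hk hij))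
  refine ⟨a, fun i => ?_⟩
  obtain ⟨j, hj⟩ := hmax i
  exact ha j i hj

/-- Finite meets `x k ⊓ ... ⊓ x (k+n)`. -/
def finMeet {X : Type*} [SemilatticeInf X] (x : ℕ → X) : ℕ → ℕ → X
  | k, 0 => x k
  | k, n + 1 => x k ⊓ finMeet x (k + 1) n

lemma finMeet_succ_le {X : Type*} [SemilatticeInf X] (x : ℕ → X) (n : ℕ) :
    ∀ k, finMeet x k (n + 1) ≤ finMeet x k n := by
  induction n with
  | zero => intro k; exact inf_le_left
  | succ n ih => intro k; exact inf_le_inf_left _ (ih (k + 1))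

/-- Good sequences of neighbourhoods. -/
def GoodSeq {Y : Type*} [Semigroup Y] [TopologicalSpace Y] (y : Y) (U : ℕ → Set Y) : Prop :=
  (∀ n, U n ∈ 𝓝 y) ∧ ∀ n, U (n + 1) ⊆ U n ∧ ∀ u ∈ U (n + 1), ∀ v ∈ U (n + 1), u * v ∈ U n

lemma exists_goodSeq {Y : Type*} [Semigroup Y] [TopologicalSpace Y]
    (hYcont : Continuous fun p : Y × Y => p.1 * p.2) (y : Y) (hy : y * y = y)
    (U : Set Y) (hU : U ∈ 𝓝 y) : ∃ V, GoodSeq y V ∧ V 0 = U := by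
  have step : ∀ W : {W // W ∈ 𝓝 y}, ∃ W' : {W // W ∈ 𝓝 y}, W'.1 ⊆ W.1 ∧
      ∀ u ∈ W'.1, ∀ v ∈ W'.1, u * v ∈ W.1 := by
    rintro ⟨W, hW⟩
    have h1 : (fun p : Y × Y => p.1 * p.2) ⁻¹' W ∈ 𝓝 (y, y) :=
      hYcont.continuousAt.preimage_mem_nhds (by simpa [hy] using hW)
    rw [nhds_prod_eq, Filter.mem_prod_same_iff] at h1
    obtain ⟨t, ht, htW⟩ := h1
    exact ⟨⟨t ∩ W, Filter.inter_mem ht hW⟩, inter_subset_right,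
      fun u hu v hv => htW (mk_mem_prod hu.1 hv.1)⟩
  choose f hf using step
  refine ⟨fun n => (f^[n] ⟨U, hU⟩).1, ⟨fun n => (f^[n] ⟨U, hU⟩).2, fun n => ?_⟩, rfl⟩
  simp only [Function.iterate_succ_apply']
  exact hf _

/-- If `X` is a k-complete topologized semilattice, `Z ⊆ X` is a closed subsemilattice and
`h : Z → Y` is a continuous homomorphism into a Hausdorff topological semigroup `Y`,
then the image `h(Z)` is closed in `Y`. -/
theorem stmt3 {X Y : Type*} [SemilatticeInf X] [TopologicalSpace X]
    [Semigroup Y] [TopologicalSpace Y] [T2Space Y]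
    (hXk : KComplete X)
    (hYcont : Continuous fun p : Y × Y => p.1 * p.2)
    (Z : Set X) (hZcl : IsClosed Z) (hZsub : ∀ a ∈ Z, ∀ b ∈ Z, a ⊓ b ∈ Z)
    (h : X → Y) (hc : ContinuousOn h Z)
    (hhom : ∀ a ∈ Z, ∀ b ∈ Z, h (a ⊓ b) = h a * h b) :
    IsClosed (h '' Z) := by
  rw [← closure_subset_iff_isClosed]
  intro y hy
  have hyy : y * y = y := by
    have hcl : IsClosed {z : Y | z * z = z} :=
      isClosed_eq (hYcont.comp (continuous_id.prodMk continuous_id)) continuous_id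
    refine closure_minimal ?_ hcl hy
    rintro _ ⟨a, ha, rfl⟩
    simp [← hhom a ha a ha]
  have hpre : ∀ F : Set Y, IsClosed F → IsClosed (Z ∩ h ⁻¹' F) := fun F hF =>
    hc.preimage_isClosed_of_isClosed hZcl hF
  -- each good sequence gives a nonempty set
  have hne : ∀ U, GoodSeq y U → ∃ a, ∀ n, a ∈ Z ∩ h ⁻¹' closure (U n) := by
    intro U hU
    have hx : ∀ n, ∃ x ∈ Z, h x ∈ U n := by
      intro n
      obtain ⟨_, h1, x, hx, rfl⟩ := mem_closure_iff_nhds.1 hy _ (hU.1 n)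
      exact ⟨x, hx, h1⟩
    choose x hxZ hxU using hx
    have hpZ : ∀ n k, finMeet x k n ∈ Z := by
      intro n
      induction n with
      | zero => intro k; exact hxZ k
      | succ n ih => intro k; exact hZsub _ (hxZ k) _ (ih (k + 1))
    have hpU : ∀ n k, h (finMeet x (k + 1) n) ∈ U k := by
      intro n
      induction n with
      | zero => intro k; exact (hU.2 k).1 (hxU (k + 1))
      | succ n ih =>
        intro k
        have : h (finMeet x (k + 1) (n + 1)) = h (x (k + 1)) * h (finMeet x (k + 1 + 1) n) :=
          hhom _ (hxZ _) _ (hpZ _ _)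
        rw [this]
        exact (hU.2 k).2 _ (hxU _) _ (ih (k + 1))
    have hanti : ∀ k, Antitone (finMeet x k) := fun k =>
      antitone_nat_of_succ_le fun n => finMeet_succ_le x n k
    have hglb : ∀ k, ∃ a, IsGLB (range (finMeet x (k + 1))) a ∧
        a ∈ closure (range (finMeet x (k + 1))) := fun k =>
      (hXk _ (range_nonempty _) (by
        rintro _ ⟨i, rfl⟩ _ ⟨j, rfl⟩ _
        rcases le_total i j with hij | hij
        · exact Or.inr (hanti _ hij)
        · exact Or.inl (hanti _ hij))).1
    choose a ha hac using hglb
    have haU : ∀ k, a k ∈ Z ∩ h ⁻¹' closure (U k) := by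
      intro k
      refine closure_minimal ?_ (hpre _ isClosed_closure) (hac k)
      rintro _ ⟨n, rfl⟩
      exact ⟨hpZ _ _, subset_closure (hpU _ _)⟩
    have hUanti : Antitone U := antitone_nat_of_succ_le fun n => (hU.2 n).1
    refine hXk.exists_sup a (monotone_nat_of_le_succ fun k => ?_) _
      (fun k => hpre _ isClosed_closure)
      (fun i j hij => ⟨(haU j).1, closure_mono (hUanti hij) (haU j).2⟩)
    refine (ha (k + 1)).2 ?_
    rintro _ ⟨n, rfl⟩
    exact ((ha k).1 ⟨n + 1, rfl⟩).trans inf_le_right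
  obtain ⟨a, ha⟩ := hXk.fip _ {U // GoodSeq y U} rfl
    (fun U => ⋂ n, Z ∩ h ⁻¹' closure (U.1 n))
    (fun U => isClosed_iInter fun n => hpre _ isClosed_closure)
    (by
      rintro ⟨U, hU⟩ a ha b hb
      simp only [mem_iInter] at ha hb ⊢
      intro n
      refine ⟨hZsub _ (ha n).1 _ (hb n).1, ?_⟩
      rw [mem_preimage, hhom _ (ha n).1 _ (hb n).1]
      exact map_mem_closure₂ hYcont (ha (n + 1)).2 (hb (n + 1)).2 (hU.2 n).2)
    (by
      intro t
      have hgood : GoodSeq y (fun n => ⋂ U ∈ t, U.1 n) := by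
        refine ⟨fun n => ?_, fun n => ⟨?_, ?_⟩⟩
        · rw [Filter.biInter_finset_mem]
          exact fun U _ => U.2.1 n
        · exact iInter₂_mono fun U _ => (U.2.2 n).1
        · intro u hu v hv
          simp only [mem_iInter] at hu hv ⊢
          exact fun U hU => (U.2.2 n).2 u (hu U hU) v (hv U hU)
      obtain ⟨a, ha⟩ := hne _ hgood
      refine ⟨a, fun U hU => mem_iInter.2 fun n => ⟨(ha n).1, ?_⟩⟩
      exact closure_mono (iInter₂_subset U hU) (ha n).2)
  simp only [mem_iInter] at ha
  obtain ⟨V, hV, _⟩ := exists_goodSeq hYcont y hyy univ Filter.univ_mem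
  refine ⟨a, (ha ⟨V, hV⟩ 0).1, ?_⟩
  by_contra hay
  obtain ⟨A, B, hA, hB, haA, hyB, hAB⟩ := t2_separation hay
  obtain ⟨V, hV, hV0⟩ := exists_goodSeq hYcont y hyy B (hB.mem_nhds hyB)
  have h1 := (ha ⟨V, hV⟩ 0).2
  simp only [hV0, mem_preimage] at h1
  obtain ⟨z, hz1, hz2⟩ := mem_closure_iff.1 h1 A hA haA
  exact hAB.le_bot ⟨hz1, hz2⟩
end

section
/- Let X be a Hausdorff semitopological semilattice. Then X is chain-finite if and only if for every closed subsemilattice Z ⊆ X and every continuous semilattice homomorphism h : Z → Y into a semitopological semilattice Y satisfying the separation axiom T₁ (all singletons of Y are closed), the image h(Z) is closed in Y. -/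
open Set Topology

universe u

/-- A semilattice `X` is *chain-finite* if every chain in `X` is finite. -/
def ChainFinite (X : Type*) [SemilatticeInf X] : Prop :=
  ∀ C : Set X, IsChain (· ≤ ·) C → C.Finite

theorem aux_min {X : Type*} [SemilatticeInf X] (hc : ChainFinite X) (A : Set X)
    (hA : A.Nonempty) : ∃ m ∈ A, ∀ x ∈ A, ¬ x < m := by
  have : WellFounded ((· < ·) : X → X → Prop) := by
    rw [RelEmbedding.wellFounded_iff_isEmpty]
    refine ⟨fun f => ?_⟩
    have hf : StrictAnti f := fun a b hab => f.map_rel_iff.2 hab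
    exact Set.infinite_range_of_injective hf.injective (hc _ hf.antitone.isChain_range)
  exact this.has_min A hA

theorem aux_max {X : Type*} [SemilatticeInf X] (hc : ChainFinite X) (A : Set X)
    (hA : A.Nonempty) : ∃ m ∈ A, ∀ x ∈ A, ¬ m < x := by
  have : WellFounded ((· > ·) : X → X → Prop) := by
    rw [RelEmbedding.wellFounded_iff_isEmpty]
    refine ⟨fun f => ?_⟩
    have hf : StrictMono f := fun a b hab => f.map_rel_iff.2 hab
    exact Set.infinite_range_of_injective hf.injective (hc _ hf.monotone.isChain_range)
  exact this.has_min A hA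

theorem aux_closed {Y : Type*} [SemilatticeInf Y] [TopologicalSpace Y] [T1Space Y]
    (h1 : ∀ a : Y, Continuous fun y : Y => a ⊓ y) (S : Set Y)
    (hS : ∀ a ∈ S, ∀ b ∈ S, a ⊓ b ∈ S)
    (hmin : ∀ A ⊆ S, A.Nonempty → ∃ m ∈ A, ∀ x ∈ A, ¬ x < m)
    (hmax : ∀ A ⊆ S, A.Nonempty → ∃ m ∈ A, ∀ x ∈ A, ¬ m < x) : IsClosed S := by
  refine isClosed_of_closure_subset fun y hy => ?_
  have hne : S.Nonempty := closure_nonempty_iff.1 ⟨y, hy⟩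
  obtain ⟨b, hbS, hb⟩ := hmin S le_rfl hne
  have hb' : ∀ x ∈ S, b ≤ x := fun x hx => by
    have := hb _ (hS b hbS x hx)
    by_contra hcon
    exact this (inf_lt_left.2 hcon)
  obtain ⟨m, ⟨hmS, U, hU, hUm⟩, hm⟩ := hmax
    {t | t ∈ S ∧ ∃ U ∈ 𝓝 y, ∀ x ∈ U, x ∈ S → t ≤ x} (fun t ht => ht.1)
    ⟨b, hbS, univ, Filter.univ_mem, fun x _ hx => hb' x hx⟩
  have hcl : y ∈ closure (U ∩ S) := by
    rw [mem_closure_iff_nhds] at hy ⊢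
    intro t ht
    obtain ⟨z, hz, hzS⟩ := hy _ (Filter.inter_mem ht hU)
    exact ⟨z, hz.1, hz.2, hzS⟩
  by_contra hyS
  have hym : y ≠ m := fun h => hyS (h ▸ hmS)
  have hex : ({s | s ∈ S ∧ m ≤ s ∧ y ⊓ s ≠ m}).Nonempty := by
    by_contra hcon
    rw [Set.not_nonempty_iff_eq_empty, Set.eq_empty_iff_forall_notMem] at hcon
    have hclosed : IsClosed {x | y ⊓ x = m} := isClosed_singleton.preimage (h1 y)
    have hsub : U ∩ S ⊆ {x | y ⊓ x = m} := fun x hx => by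
      by_contra hx'
      exact hcon x ⟨hx.2, hUm x hx.1 hx.2, hx'⟩
    have := closure_minimal hsub hclosed hcl
    exact hym (by simpa using this)
  obtain ⟨s, ⟨hsS, hms, hys⟩, hs⟩ := hmin _ (fun t ht => ht.1) hex
  have hW : {x | (y ⊓ s) ⊓ x ≠ m} ∈ 𝓝 y := by
    have hclosed : IsClosed {x | (y ⊓ s) ⊓ x = m} := isClosed_singleton.preimage (h1 _)
    refine hclosed.isOpen_compl.mem_nhds ?_
    change ¬ ((y ⊓ s) ⊓ y = m)
    rwa [inf_eq_left.2 inf_le_left]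
  have hsm : s ≠ m := by
    rintro rfl
    apply hys
    have hclosed : IsClosed {x | s ⊓ x = s} := isClosed_singleton.preimage (h1 s)
    have := closure_minimal (fun x hx => inf_eq_left.2 (hUm x hx.1 hx.2)) hclosed hcl
    rw [inf_comm]
    exact this
  refine hm s ⟨hsS, _, Filter.inter_mem hU hW, ?_⟩ (lt_of_le_of_ne hms hsm.symm)
  rintro x ⟨hxU, hxW⟩ hxS
  have := hs (s ⊓ x) ⟨hS _ hsS _ hxS, le_inf hms (hUm x hxU hxS), by
    rw [← inf_assoc]; exact hxW⟩
  by_contra hcon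
  exact this (inf_lt_left.2 hcon)

theorem aux_forward {X : Type*} [SemilatticeInf X] (hc : ChainFinite X) (Z : Set X)
    (hZ : ∀ a ∈ Z, ∀ b ∈ Z, a ⊓ b ∈ Z)
    {Y : Type*} [SemilatticeInf Y] [TopologicalSpace Y] [T1Space Y]
    (h1 : ∀ a : Y, Continuous fun y : Y => a ⊓ y) (h : X → Y)
    (hh : ∀ a ∈ Z, ∀ b ∈ Z, h (a ⊓ b) = h a ⊓ h b) : IsClosed (h '' Z) := by
  have key : ∀ y ∈ h '' Z, ∃ m ∈ Z, h m = y ∧ ∀ z ∈ Z, h z = y → m ≤ z := by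
    rintro y ⟨z, hz, rfl⟩
    obtain ⟨m, ⟨hmZ, hm⟩, hmin⟩ := aux_min hc {x | x ∈ Z ∧ h x = h z} ⟨z, hz, rfl⟩
    refine ⟨m, hmZ, hm, fun w hw hwz => ?_⟩
    by_contra hcon
    exact hmin (m ⊓ w) ⟨hZ _ hmZ _ hw, by rw [hh _ hmZ _ hw, hm, hwz, inf_idem]⟩
      (inf_lt_left.2 hcon)
  rcases Z.eq_empty_or_nonempty with rfl | ⟨z0, _⟩
  · simp
  haveI : Nonempty X := ⟨z0⟩
  choose! m hmZ hm hmin using key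
  have mono : ∀ a ∈ h '' Z, ∀ b ∈ h '' Z, a < b → m a < m b := by
    intro a ha b hb hab
    refine lt_of_le_of_ne ?_ ?_
    · have := hmin a ha (m a ⊓ m b) (hZ _ (hmZ a ha) _ (hmZ b hb))
        (by rw [hh _ (hmZ a ha) _ (hmZ b hb), hm a ha, hm b hb, inf_eq_left.2 hab.le])
      exact this.trans inf_le_right
    · intro heq
      have := congrArg h heq
      rw [hm a ha, hm b hb] at this
      exact hab.ne this
  refine aux_closed h1 _ ?_ ?_ ?_
  · rintro _ ⟨a, ha, rfl⟩ _ ⟨b, hb, rfl⟩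
    exact ⟨a ⊓ b, hZ a ha b hb, hh a ha b hb⟩
  · intro A hA hne
    obtain ⟨_, ⟨a, ha, rfl⟩, hmn⟩ := aux_min hc (m '' A) (hne.image m)
    exact ⟨a, ha, fun x hx hlt => hmn _ ⟨x, hx, rfl⟩ (mono _ (hA hx) _ (hA ha) hlt)⟩
  · intro A hA hne
    obtain ⟨_, ⟨a, ha, rfl⟩, hmn⟩ := aux_max hc (m '' A) (hne.image m)
    exact ⟨a, ha, fun x hx hlt => hmn _ ⟨x, hx, rfl⟩ (mono _ (hA ha) _ (hA hx) hlt)⟩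

theorem aux_chain_closed {X : Type*} [SemilatticeInf X] [TopologicalSpace X] [T2Space X]
    (h1 : ∀ a : X, Continuous fun x : X => a ⊓ x) (Z : Set X)
    (hZ : IsMaxChain (· ≤ ·) Z) : IsClosed Z := by
  have hcmp : ∀ a : X, IsClosed {x | a ≤ x ∨ x ≤ a} := fun a => by
    have e : {x | a ≤ x ∨ x ≤ a} = {x | a ⊓ x = a} ∪ {x | a ⊓ x = x} := by
      ext x; simp
    rw [e]
    exact (isClosed_eq (h1 a) continuous_const).union (isClosed_eq (h1 a) continuous_id)
  refine isClosed_of_closure_subset fun y hy => ?_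
  have hch : IsChain (· ≤ ·) (insert y Z) := by
    refine hZ.1.insert fun b hb _ => ?_
    exact (closure_minimal (fun x hx => hZ.1.total hb hx) (hcmp b) hy).symm
  rw [hZ.2 hch (subset_insert _ _)]
  exact mem_insert _ _

/-- The topology on a semilattice whose closed subbase consists of the fibres of shifts. -/
@[reducible] def shiftTop (Y : Type*) [SemilatticeInf Y] : TopologicalSpace Y :=
  TopologicalSpace.generateFrom {s | ∃ a b : Y, s = {y | a ⊓ y = b}ᶜ}

theorem shiftTop_cofinite {Y : Type*} [SemilatticeInf Y] [OrderTop Y]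
    (htot : ∀ a b : Y, a ≤ b ∨ b ≤ a) (U : Set Y) (hU : IsOpen[shiftTop Y] U)
    (hp : ⊤ ∈ U) : Uᶜ.Finite := by
  induction hU with
  | basic s hs =>
    obtain ⟨a, b, rfl⟩ := hs
    rw [compl_compl]
    refine (Set.finite_singleton b).subset fun y hy => ?_
    have hab : a ≠ b := by simpa using hp
    have hy' : a ⊓ y = b := hy
    rcases htot a y with h | h
    · rw [inf_eq_left.2 h] at hy'; exact absurd hy' hab
    · rw [inf_eq_right.2 h] at hy'; exact hy'
  | univ => simp
  | inter s t _ _ h1 h2 =>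
    rw [compl_inter]
    exact (h1 hp.1).union (h2 hp.2)
  | sUnion S _ ih =>
    obtain ⟨s, hs, hps⟩ := hp
    exact (ih s hs hps).subset (compl_subset_compl.2 (subset_sUnion_of_mem hs))

/-- A Hausdorff semitopological semilattice `X` is chain-finite if and only if for every
closed subsemilattice `Z ⊆ X` and every continuous semilattice homomorphism `h : Z → Y`
into a `T₁` semitopological semilattice `Y`, the image `h(Z)` is closed in `Y`. -/
theorem stmt10 {X : Type u} [SemilatticeInf X] [TopologicalSpace X] [T2Space X]
    (hsep₁ : ∀ a : X, Continuous fun x : X => a ⊓ x)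
    (hsep₂ : ∀ a : X, Continuous fun x : X => x ⊓ a) :
    ChainFinite X ↔
      ∀ Z : Set X, IsClosed Z → (∀ a ∈ Z, ∀ b ∈ Z, a ⊓ b ∈ Z) →
        ∀ (Y : Type u) [SemilatticeInf Y] [TopologicalSpace Y] [T1Space Y],
          (∀ a : Y, Continuous fun y : Y => a ⊓ y) →
          (∀ a : Y, Continuous fun y : Y => y ⊓ a) →
          ∀ h : X → Y, ContinuousOn h Z →
            (∀ a ∈ Z, ∀ b ∈ Z, h (a ⊓ b) = h a ⊓ h b) →
            IsClosed (h '' Z) := by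
  classical
  constructor
  · intro hc Z _ hZ Y _ _ _ h1 _ h _ hh
    exact aux_forward hc Z hZ h1 h hh
  · intro H
    by_contra hc
    simp only [ChainFinite, not_forall] at hc
    obtain ⟨C, hC, hinf⟩ := hc
    obtain ⟨Z, hZ, hCZ⟩ := hC.exists_maxChain
    have hZinf : Z.Infinite := fun hf => hinf (hf.subset hCZ)
    have hZc : IsClosed Z := aux_chain_closed hsep₁ Z hZ
    have hZi : ∀ a ∈ Z, ∀ b ∈ Z, a ⊓ b ∈ Z := by
      intro a ha b hb
      rcases hZ.1.total ha hb with h | h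
      · rwa [inf_eq_left.2 h]
      · rwa [inf_eq_right.2 h]
    let _ : SemilatticeInf Z := Subtype.semilatticeInf (fun {a b} ha hb => hZi a ha b hb)
    let _ : TopologicalSpace (WithTop Z) := shiftTop (WithTop Z)
    have hcl : ∀ a b : WithTop Z, IsClosed {y | a ⊓ y = b} := fun a b =>
      ⟨TopologicalSpace.isOpen_generateFrom_of_mem ⟨a, b, rfl⟩⟩
    have : T1Space (WithTop Z) := ⟨fun b => by simpa using hcl ⊤ b⟩
    have hs : ∀ a : WithTop Z, Continuous fun y : WithTop Z => a ⊓ y := by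
      intro a
      refine continuous_generateFrom_iff.2 ?_
      rintro _ ⟨c, d, rfl⟩
      have := (hcl (c ⊓ a) d).isOpen_compl
      convert this using 1
      ext y
      simp [inf_assoc]
    have htot : ∀ a b : WithTop Z, a ≤ b ∨ b ≤ a := by
      intro a b
      induction a with
      | top => right; exact le_top
      | coe a =>
        induction b with
        | top => left; exact le_top
        | coe b =>
          rw [WithTop.coe_le_coe, WithTop.coe_le_coe]
          exact hZ.1.total a.2 b.2
    let h : X → WithTop Z := fun x => if hx : x ∈ Z then ((⟨x, hx⟩ : Z) : WithTop Z) else ⊤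
    have hh : ∀ x (hx : x ∈ Z), h x = ((⟨x, hx⟩ : Z) : WithTop Z) := fun x hx => dif_pos hx
    have hcont : ContinuousOn h Z := by
      rw [continuousOn_iff_continuous_domRestrict]
      have e : Z.domRestrict h = fun z : Z => (z : WithTop Z) := by
        ext1 z
        exact hh z.1 z.2
      rw [e]
      refine continuous_generateFrom_iff.2 ?_
      rintro _ ⟨c, d, rfl⟩
      rw [preimage_compl, isOpen_compl_iff]
      induction d with
      | top =>
        convert isClosed_empty
        ext z
        simp
      | coe d =>
        induction c with
        | top =>
          convert isClosed_singleton (x := d)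
          ext z
          simp
        | coe c =>
          have : IsClosed {z : Z | (c : X) ⊓ (z : X) = d} :=
            isClosed_eq ((hsep₁ _).comp continuous_subtype_val) continuous_const
          convert this using 1
          ext z
          change ((c : WithTop Z) ⊓ (z : WithTop Z) = d) ↔ _
          rw [← WithTop.coe_inf, WithTop.coe_inj, Subtype.ext_iff]
          rfl
    have hcl2 : IsClosed (h '' Z) := by
      refine H Z hZc hZi (WithTop Z) hs (fun a => by simpa only [inf_comm] using hs a) h hcont ?_
      intro a ha b hb
      rw [hh a ha, hh b hb, hh _ (hZi a ha b hb), ← WithTop.coe_inf]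
      rfl
    have hfin := shiftTop_cofinite htot _ hcl2.isOpen_compl (by
      rintro ⟨x, hx, hx'⟩
      rw [hh x hx] at hx'
      exact WithTop.coe_ne_top hx')
    rw [compl_compl] at hfin
    refine hZinf (Set.Finite.of_finite_image hfin ?_)
    intro a ha b hb hab
    rw [hh a ha, hh b hb, WithTop.coe_inj, Subtype.ext_iff] at hab
    exact hab
end

section
/- Let X be a Hausdorff topological semilattice. Then X is chain-finite if and only if for every closed subsemilattice Z ⊆ X and every continuous semilattice homomorphism h : Z → Y into a topological semilattice Y satisfying the separation axiom T₁ (all singletons of Y are closed), the image h(Z) is closed in Y. -/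
open Set Topology

universe u

/-- A subset of a `T₁` topological semilattice closed under meets whose nonempty subsets have
minimal and maximal elements is closed. -/
lemma closed_of_min_max {Y : Type*} [SemilatticeInf Y] [TopologicalSpace Y] [T1Space Y]
    (hc : Continuous fun p : Y × Y => p.1 ⊓ p.2) (S : Set Y)
    (hS : ∀ a ∈ S, ∀ b ∈ S, a ⊓ b ∈ S)
    (hmin : ∀ T : Set Y, T ⊆ S → T.Nonempty → ∃ t ∈ T, ∀ s ∈ T, ¬ s < t)
    (hmax : ∀ T : Set Y, T ⊆ S → T.Nonempty → ∃ t ∈ T, ∀ s ∈ T, ¬ t < s) :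
    IsClosed S := by
  have hcl : ∀ e : Y, IsClosed (Ici e) := by
    intro e
    have h1 : Continuous fun x : Y => e ⊓ x := hc.comp (Continuous.prodMk_right e)
    have h2 : Ici e = (fun x : Y => e ⊓ x) ⁻¹' {e} := by
      ext x; simp
    rw [h2]; exact isClosed_singleton.preimage h1
  refine isClosed_of_closure_subset fun y hy => ?_
  by_contra hyS
  have hSne : S.Nonempty := closure_nonempty_iff.1 ⟨y, hy⟩
  obtain ⟨m, hmS, hm⟩ := hmin S subset_rfl hSne
  have hmle : ∀ s ∈ S, m ≤ s := by
    intro s hs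
    by_contra hcon
    refine hm (m ⊓ s) (hS _ hmS _ hs) (lt_of_le_of_ne inf_le_left fun h => hcon ?_)
    exact inf_eq_left.1 h
  obtain ⟨e, ⟨heS, hey⟩, he⟩ := hmax {e | e ∈ S ∧ y ∈ closure (S ∩ Ici e)} (fun _ h => h.1)
    ⟨m, hmS, by
      have hsub : S ⊆ Ici m := fun s hs => hmle s hs
      rwa [inter_eq_left.2 hsub]⟩
  have hey' : e ≤ y := by
    have := closure_mono (inter_subset_right : S ∩ Ici e ⊆ Ici e) hey
    rwa [(hcl e).closure_eq] at this
  have hne : y ≠ e := fun h => hyS (h ▸ heS)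
  have hopen : ∀ w : Y, IsOpen {x : Y | (w ⊓ x) ⊓ y ≠ e} := by
    intro w
    have h1 : Continuous fun x : Y => (w ⊓ x) ⊓ y :=
      hc.comp ((hc.comp (Continuous.prodMk_right w)).prodMk continuous_const)
    exact isOpen_compl_singleton.preimage h1
  have hopen' : IsOpen {x : Y | x ⊓ y ≠ e} := by
    have h1 : Continuous fun x : Y => x ⊓ y := hc.comp (continuous_id.prodMk continuous_const)
    exact isOpen_compl_singleton.preimage h1
  obtain ⟨w, ⟨hwS, hew, hw⟩, hwmin⟩ := hmin {w | w ∈ S ∧ e ≤ w ∧ w ⊓ y ≠ e} (fun _ h => h.1) (by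
    obtain ⟨x, hx1, hx2, hx3⟩ := mem_closure_iff.1 hey _ hopen' (by simpa using hne)
    exact ⟨x, hx2, hx3, hx1⟩)
  have hewlt : e < w := lt_of_le_of_ne hew (by
    rintro rfl; exact hw (inf_eq_left.2 hey'))
  have hyw : y ∉ closure (S ∩ Ici w) := fun h => he w ⟨hwS, h⟩ hewlt
  obtain ⟨x, ⟨hx1, hx1'⟩, hx2, hx3⟩ := mem_closure_iff.1 hey
    ({x : Y | (w ⊓ x) ⊓ y ≠ e} ∩ (closure (S ∩ Ici w))ᶜ)
    ((hopen w).inter isClosed_closure.isOpen_compl)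
    ⟨by simpa [inf_assoc] using hw, hyw⟩
  refine hwmin (w ⊓ x) ⟨hS _ hwS _ hx2, le_inf hew hx3, hx1⟩
    (lt_of_le_of_ne inf_le_left fun h => hx1' (subset_closure ⟨hx2, inf_eq_left.1 h⟩))

lemma ChainFinite.wf_lt {X : Type*} [SemilatticeInf X] (h : ChainFinite X) :
    WellFounded ((· < ·) : X → X → Prop) := by
  rw [wellFounded_iff_isEmpty_descending_chain]
  refine ⟨fun ⟨f, hf⟩ => ?_⟩
  have ha : StrictAnti f := strictAnti_nat_of_succ_lt hf
  refine infinite_range_of_injective ha.injective (h _ ?_)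
  rintro _ ⟨m, rfl⟩ _ ⟨n, rfl⟩ _
  rcases le_total m n with k | k
  · exact Or.inr (ha.antitone k)
  · exact Or.inl (ha.antitone k)

lemma ChainFinite.wf_gt {X : Type*} [SemilatticeInf X] (h : ChainFinite X) :
    WellFounded ((· > ·) : X → X → Prop) := by
  rw [wellFounded_iff_isEmpty_descending_chain]
  refine ⟨fun ⟨f, hf⟩ => ?_⟩
  have ha : StrictMono f := strictMono_nat_of_lt_succ hf
  refine infinite_range_of_injective ha.injective (h _ ?_)
  rintro _ ⟨m, rfl⟩ _ ⟨n, rfl⟩ _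
  rcases le_total m n with k | k
  · exact Or.inl (ha.monotone k)
  · exact Or.inr (ha.monotone k)

lemma forward_dir {X Y : Type*} [SemilatticeInf X] (hX : ChainFinite X) (Z : Set X)
    (hZ : ∀ a ∈ Z, ∀ b ∈ Z, a ⊓ b ∈ Z)
    [SemilatticeInf Y] [TopologicalSpace Y] [T1Space Y]
    (hc : Continuous fun p : Y × Y => p.1 ⊓ p.2) (h : X → Y)
    (hh : ∀ a ∈ Z, ∀ b ∈ Z, h (a ⊓ b) = h a ⊓ h b) : IsClosed (h '' Z) := by
  have hsec : ∀ y : Y, y ∈ h '' Z → ∃ z ∈ Z, h z = y ∧ ∀ z' ∈ Z, h z' = y → z ≤ z' := by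
    rintro y ⟨z₀, hz₀, hy₀⟩
    obtain ⟨z, ⟨hz, hzy⟩, hmin⟩ := hX.wf_lt.has_min {z | z ∈ Z ∧ h z = y} ⟨z₀, hz₀, hy₀⟩
    refine ⟨z, hz, hzy, fun z' hz' hzy' => ?_⟩
    by_contra hcon
    refine hmin (z ⊓ z') ⟨hZ _ hz _ hz', by rw [hh _ hz _ hz', hzy, hzy', inf_idem]⟩
      (lt_of_le_of_ne inf_le_left fun k => hcon (inf_eq_left.1 k))
  rcases Z.eq_empty_or_nonempty with rfl | ⟨z₁, -⟩
  · simp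
  have : Nonempty X := ⟨z₁⟩
  choose! m hmZ hmy hmle using hsec
  have hmono : ∀ a ∈ h '' Z, ∀ b ∈ h '' Z, a < b → m a < m b := by
    intro a ha b hb hab
    have h1 : m a ≤ m a ⊓ m b := hmle a ha _ (hZ _ (hmZ a ha) _ (hmZ b hb)) (by
      rw [hh _ (hmZ a ha) _ (hmZ b hb), hmy a ha, hmy b hb, inf_eq_left.2 hab.le])
    refine lt_of_le_of_ne (h1.trans inf_le_right) fun k => hab.ne ?_
    rw [← hmy a ha, ← hmy b hb, k]
  refine closed_of_min_max hc _ ?_ ?_ ?_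
  · rintro _ ⟨a, ha, rfl⟩ _ ⟨b, hb, rfl⟩
    exact ⟨a ⊓ b, hZ _ ha _ hb, hh _ ha _ hb⟩
  · intro T hT hne
    obtain ⟨_, ⟨t, ht, rfl⟩, hmin⟩ := hX.wf_lt.has_min (m '' T) (hne.image m)
    exact ⟨t, ht, fun s hs hst =>
      hmin (m s) (mem_image_of_mem m hs) (hmono _ (hT hs) _ (hT ht) hst)⟩
  · intro T hT hne
    obtain ⟨_, ⟨t, ht, rfl⟩, hmin⟩ := hX.wf_gt.has_min (m '' T) (hne.image m)
    exact ⟨t, ht, fun s hs hst =>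
      hmin (m s) (mem_image_of_mem m hs) (hmono _ (hT ht) _ (hT hs) hst)⟩

/-- The right-hand side of the main theorem. -/
def ClosedImages (X : Type u) [SemilatticeInf X] [TopologicalSpace X] : Prop :=
  ∀ Z : Set X, IsClosed Z → (∀ a ∈ Z, ∀ b ∈ Z, a ⊓ b ∈ Z) →
    ∀ (Y : Type u) [SemilatticeInf Y] [TopologicalSpace Y] [T1Space Y],
      (Continuous fun p : Y × Y => p.1 ⊓ p.2) →
      ∀ h : X → Y, ContinuousOn h Z →
        (∀ a ∈ Z, ∀ b ∈ Z, h (a ⊓ b) = h a ⊓ h b) →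
        IsClosed (h '' Z)

section orders

variable {X : Type u} [SemilatticeInf X] [TopologicalSpace X] [T2Space X]

lemma isClosed_ge (hc : Continuous fun p : X × X => p.1 ⊓ p.2) (e : X) : IsClosed (Ici e) := by
  have h1 : Continuous fun x : X => e ⊓ x := hc.comp (Continuous.prodMk_right e)
  have h2 : Ici e = (fun x : X => e ⊓ x) ⁻¹' {e} := by
    ext x; simp
  rw [h2]; exact isClosed_singleton.preimage h1

lemma isClosed_le' (hc : Continuous fun p : X × X => p.1 ⊓ p.2) (e : X) : IsClosed (Iic e) := by
  have h1 : Continuous fun x : X => e ⊓ x := hc.comp (Continuous.prodMk_right e)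
  have h2 : Iic e = {x : X | e ⊓ x = x} := by
    ext x; simp
  rw [h2]; exact isClosed_eq h1 continuous_id

lemma asc_closure (hc : Continuous fun p : X × X => p.1 ⊓ p.2) {x : ℕ → X} (hx : StrictMono x)
    {z : X} (hz : z ∈ closure (range x)) (hz' : z ∉ range x) (n : ℕ) : x n ≤ z := by
  have h1 : range x ⊆ x '' (Iio n) ∪ Ici (x n) := by
    rintro _ ⟨m, rfl⟩
    rcases lt_or_ge m n with k | k
    · exact Or.inl ⟨m, k, rfl⟩
    · exact Or.inr (hx.monotone k)
  have h2 : IsClosed (x '' (Iio n) ∪ Ici (x n)) :=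
    ((finite_Iio n).image x).isClosed.union (isClosed_ge hc _)
  rcases closure_minimal h1 h2 hz with ⟨m, _, k⟩ | k
  · exact absurd ⟨m, k⟩ hz'
  · exact k

lemma desc_closure (hc : Continuous fun p : X × X => p.1 ⊓ p.2) {x : ℕ → X} (hx : StrictAnti x)
    {z : X} (hz : z ∈ closure (range x)) (hz' : z ∉ range x) (n : ℕ) : z ≤ x n := by
  have h1 : range x ⊆ x '' (Iio n) ∪ Iic (x n) := by
    rintro _ ⟨m, rfl⟩
    rcases lt_or_ge m n with k | k
    · exact Or.inl ⟨m, k, rfl⟩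
    · exact Or.inr (hx.antitone k)
  have h2 : IsClosed (x '' (Iio n) ∪ Iic (x n)) :=
    ((finite_Iio n).image x).isClosed.union (isClosed_le' hc _)
  rcases closure_minimal h1 h2 hz with ⟨m, _, k⟩ | k
  · exact absurd ⟨m, k⟩ hz'
  · exact k

lemma asc_unique (hc : Continuous fun p : X × X => p.1 ⊓ p.2) {x : ℕ → X} (hx : StrictMono x)
    {z w : X} (hz : z ∈ closure (range x)) (hz' : z ∉ range x)
    (hw : w ∈ closure (range x)) (hw' : w ∉ range x) : z = w := by
  apply le_antisymm
  · refine closure_minimal ?_ (isClosed_le' hc w) hz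
    rintro _ ⟨n, rfl⟩; exact asc_closure hc hx hw hw' n
  · refine closure_minimal ?_ (isClosed_le' hc z) hw
    rintro _ ⟨n, rfl⟩; exact asc_closure hc hx hz hz' n

lemma desc_unique (hc : Continuous fun p : X × X => p.1 ⊓ p.2) {x : ℕ → X} (hx : StrictAnti x)
    {z w : X} (hz : z ∈ closure (range x)) (hz' : z ∉ range x)
    (hw : w ∈ closure (range x)) (hw' : w ∉ range x) : z = w := by
  apply le_antisymm
  · refine closure_minimal ?_ (isClosed_ge hc z) hw
    rintro _ ⟨n, rfl⟩; exact desc_closure hc hx hz hz' n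
  · refine closure_minimal ?_ (isClosed_ge hc w) hz
    rintro _ ⟨n, rfl⟩; exact desc_closure hc hx hw hw' n

/-- No strictly ascending sequences, given a suitable target. -/
lemma no_asc (hc : Continuous fun p : X × X => p.1 ⊓ p.2) (H : ClosedImages X)
    {x : ℕ → X} (hx : StrictMono x) (L : Type u) [LinearOrder L] (e : ℕ → L) (he : StrictMono e)
    (p t : L) (hep : ∀ n, e n < p) (hpt : p < t) (hcov : ∀ c, c = p ∨ c = t ∨ ∃ n, c = e n) :
    False := by
  classical
  let τ : TopologicalSpace L := TopologicalSpace.generateFrom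
    (range (fun c : L => (Ici c)ᶜ) ∪ range (fun c : L => {c}ᶜ))
  have hIci : ∀ c : L, IsClosed (Ici c) := fun c =>
    ⟨TopologicalSpace.isOpen_generateFrom_of_mem (Or.inl ⟨c, rfl⟩)⟩
  have hsing : ∀ c : L, IsClosed ({c} : Set L) := fun c =>
    ⟨TopologicalSpace.isOpen_generateFrom_of_mem (Or.inr ⟨c, rfl⟩)⟩
  have : T1Space L := ⟨hsing⟩
  have hcont : Continuous fun q : L × L => q.1 ⊓ q.2 := by
    refine continuous_generateFrom_iff.2 ?_
    rintro _ (⟨c, rfl⟩ | ⟨c, rfl⟩)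
    · have : (fun q : L × L => q.1 ⊓ q.2) ⁻¹' (Ici c)ᶜ = (Ici c ×ˢ Ici c)ᶜ := by
        ext q
        simp only [mem_preimage, mem_compl_iff, mem_prod, mem_Ici, le_inf_iff]
      rw [this]
      exact ((hIci c).prod (hIci c)).isOpen_compl
    · have : (fun q : L × L => q.1 ⊓ q.2) ⁻¹' {c}ᶜ = ({c} ×ˢ Ici c ∪ Ici c ×ˢ {c})ᶜ := by
        ext q
        simp only [mem_preimage, mem_compl_iff, mem_singleton_iff, mem_union, mem_prod, mem_Ici]
        rcases le_total q.1 q.2 with k | k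
        · rw [inf_eq_left.2 k]; grind
        · rw [inf_eq_right.2 k]; grind
      rw [this]
      exact (((hsing c).prod (hIci c)).union ((hIci c).prod (hsing c))).isOpen_compl
  let h : X → L := fun z => if k : z ∈ range x then e k.choose else t
  have hxn : ∀ n, h (x n) = e n := by
    intro n
    have k : x n ∈ range x := ⟨n, rfl⟩
    simp only [h, dif_pos k]
    rw [hx.injective k.choose_spec]
  have hxt : ∀ z, z ∉ range x → h z = t := fun z hz => by simp only [h, dif_neg hz]
  have het : ∀ n, e n < t := fun n => (hep n).trans hpt
  let Z := closure (range x)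
  have hle : ∀ z ∈ Z, ∀ w ∈ Z, z ≤ w → h z ≤ h w := by
    intro z hz w hw hzw
    by_cases kw : w ∈ range x
    · by_cases kz : z ∈ range x
      · obtain ⟨n, rfl⟩ := kz
        obtain ⟨m, rfl⟩ := kw
        rw [hxn, hxn]; exact he.monotone (hx.le_iff_le.1 hzw)
      · obtain ⟨m, rfl⟩ := kw
        have := asc_closure hc hx hz kz (m + 1)
        exact absurd (this.trans hzw) (hx (Nat.lt_succ_self m)).not_ge
    · rw [hxt w kw]
      by_cases kz : z ∈ range x
      · obtain ⟨n, rfl⟩ := kz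
        rw [hxn]; exact (het n).le
      · rw [hxt z kz]
  have htot : ∀ z ∈ Z, ∀ w ∈ Z, z ≤ w ∨ w ≤ z := by
    intro z hz w hw
    by_cases kz : z ∈ range x
    · obtain ⟨n, rfl⟩ := kz
      by_cases kw : w ∈ range x
      · obtain ⟨m, rfl⟩ := kw
        exact (le_total n m).imp (fun k => hx.monotone k) (fun k => hx.monotone k)
      · exact Or.inl (asc_closure hc hx hw kw n)
    · by_cases kw : w ∈ range x
      · obtain ⟨m, rfl⟩ := kw
        exact Or.inr (asc_closure hc hx hz kz m)
      · exact Or.inl (asc_unique hc hx hz kz hw kw).le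
  have hrest : IsClosed (Z \ range x) :=
    (Set.Subsingleton.finite fun a ha b hb =>
      asc_unique hc hx ha.1 ha.2 hb.1 hb.2).isClosed
  have hcl := H Z isClosed_closure
    (by
      intro a ha b hb
      rcases htot a ha b hb with k | k
      · rwa [inf_eq_left.2 k]
      · rwa [inf_eq_right.2 k]) L hcont h
    (by
      rw [continuousOn_iff_continuous_domRestrict]
      refine continuous_generateFrom_iff.2 ?_
      have key : ∀ (s : Set L) (c : Set X), IsClosed c → (∀ z ∈ Z, h z ∈ s ↔ z ∈ c) →
          IsOpen (Z.domRestrict h ⁻¹' sᶜ) := by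
        intro s c hcc hs
        have : Z.domRestrict h ⁻¹' sᶜ = ((Subtype.val : Z → X) ⁻¹' c)ᶜ := by
          ext ⟨z, hz⟩; exact not_congr (hs z hz)
        rw [this]; exact (hcc.preimage continuous_subtype_val).isOpen_compl
      have hin : ∀ z ∈ Z, (z ∈ Z \ range x ↔ z ∉ range x) := fun z hz => by simp [hz]
      rintro _ (⟨c, rfl⟩ | ⟨c, rfl⟩)
      · rcases hcov c with rfl | rfl | ⟨n, rfl⟩
        · refine key _ _ hrest fun z hz => ?_
          rw [hin z hz]
          by_cases k : z ∈ range x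
          · obtain ⟨n, rfl⟩ := k
            simp [hxn, hep n]
          · simp only [k, hxt z k, mem_Ici]; simp [hpt.le]
        · refine key _ _ hrest fun z hz => ?_
          rw [hin z hz]
          by_cases k : z ∈ range x
          · obtain ⟨n, rfl⟩ := k
            simp [hxn, het n]
          · simp only [k, hxt z k, mem_Ici]; simp
        · refine key _ _ (isClosed_ge hc (x n)) fun z hz => ?_
          by_cases k : z ∈ range x
          · obtain ⟨m, rfl⟩ := k
            simp [hxn, he.le_iff_le, hx.le_iff_le]
          · simp only [hxt z k, mem_Ici]
            exact iff_of_true (het n).le (asc_closure hc hx hz k n)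
      · rcases hcov c with rfl | rfl | ⟨n, rfl⟩
        · refine key _ ∅ isClosed_empty fun z hz => ?_
          by_cases k : z ∈ range x
          · obtain ⟨n, rfl⟩ := k
            simp [hxn, (hep n).ne]
          · simp [hxt z k, hpt.ne']
        · refine key _ _ hrest fun z hz => ?_
          rw [hin z hz]
          by_cases k : z ∈ range x
          · obtain ⟨n, rfl⟩ := k
            simp [hxn, (het n).ne]
          · simp only [k, hxt z k, mem_singleton_iff]; simp
        · refine key _ {x n} isClosed_singleton fun z hz => ?_
          by_cases k : z ∈ range x
          · obtain ⟨m, rfl⟩ := k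
            simp [hxn, he.injective.eq_iff, hx.injective.eq_iff]
          · simp only [hxt z k, mem_singleton_iff]
            exact iff_of_false (het n).ne' (fun h => k ⟨n, h.symm⟩))
    (by
      intro a ha b hb
      rcases htot a ha b hb with k | k
      · rw [inf_eq_left.2 k, inf_eq_left.2 (hle a ha b hb k)]
      · rw [inf_eq_right.2 k, inf_eq_right.2 (hle b hb a ha k)])
  have hlim : Filter.Tendsto e Filter.atTop (𝓝 p) := by
    refine TopologicalSpace.tendsto_nhds_generateFrom_iff.2 ?_
    rintro _ (⟨c, rfl⟩ | ⟨c, rfl⟩) hp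
    · refine Filter.Eventually.of_forall fun n => ?_
      simp only [mem_compl_iff, mem_Ici, not_le, mem_preimage] at hp ⊢
      exact (hep n).trans hp
    · rcases hcov c with rfl | rfl | ⟨n, rfl⟩
      · exact absurd rfl hp
      · exact Filter.Eventually.of_forall fun n => (het n).ne
      · filter_upwards [Filter.eventually_gt_atTop n] with m hm
        exact (he hm).ne'
  have hpm : p ∈ h '' Z := hcl.mem_of_tendsto hlim (Filter.Eventually.of_forall fun n =>
    ⟨x n, subset_closure ⟨n, rfl⟩, hxn n⟩)
  obtain ⟨z, hz, hzp⟩ := hpm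
  by_cases k : z ∈ range x
  · obtain ⟨n, rfl⟩ := k
    rw [hxn] at hzp; exact (hep n).ne hzp
  · rw [hxt z k] at hzp; exact hpt.ne' hzp

/-- No strictly descending sequences, given a suitable target. -/
lemma no_desc (hc : Continuous fun p : X × X => p.1 ⊓ p.2) (H : ClosedImages X)
    {x : ℕ → X} (hx : StrictAnti x) (L : Type u) [SemilatticeInf L] [OrderBot L] (e : ℕ → L)
    (he : Function.Injective e) (heanti : Antitone e)
    (p : L) (hep : ∀ n, e n ≠ p) (hp : p ≠ ⊥) (heb : ∀ n, e n ≠ ⊥)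
    (hprime : ∀ a b : L, a ⊓ b = ⊥ → a = ⊥ ∨ b = ⊥)
    (hfin : ∀ c : L, c ≠ ⊥ → (Ici c).Finite) :
    False := by
  classical
  let τ : TopologicalSpace L := TopologicalSpace.cofinite
  have hclosed : ∀ s : Set L, IsClosed s ↔ s = univ ∨ s.Finite := by
    intro s
    rw [← isOpen_compl_iff]
    change (sᶜ.Nonempty → sᶜᶜ.Finite) ↔ _
    rw [compl_compl, nonempty_compl, or_iff_not_imp_left]
  have : T1Space L := ⟨fun c => (hclosed _).2 (Or.inr (finite_singleton c))⟩
  have hcont : Continuous fun q : L × L => q.1 ⊓ q.2 := by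
    have hs : ∀ c : L, IsClosed ((fun q : L × L => q.1 ⊓ q.2) ⁻¹' {c}) := by
      intro c
      by_cases hcb : c = ⊥
      · have : (fun q : L × L => q.1 ⊓ q.2) ⁻¹' {c} =
            (Prod.fst ⁻¹' {⊥}) ∪ (Prod.snd ⁻¹' {⊥}) := by
          ext q
          simp only [mem_preimage, mem_singleton_iff, mem_union, hcb]
          refine ⟨hprime _ _, ?_⟩
          rintro (k | k) <;> simp [k]
        rw [this]
        exact (isClosed_singleton.preimage continuous_fst).union
          (isClosed_singleton.preimage continuous_snd)
      · refine Set.Finite.isClosed (((hfin c hcb).prod (hfin c hcb)).subset ?_)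
        rintro q hq
        simp only [mem_preimage, mem_singleton_iff] at hq
        exact ⟨hq ▸ inf_le_left, hq ▸ inf_le_right⟩
    refine continuous_iff_isClosed.2 fun s hsc => ?_
    rcases (hclosed s).1 hsc with rfl | k
    · simp
    · rw [← biUnion_of_singleton s, preimage_iUnion₂]
      exact k.isClosed_biUnion fun c _ => hs c
  let h : X → L := fun z => if k : z ∈ range x then e k.choose else ⊥
  have hxn : ∀ n, h (x n) = e n := by
    intro n
    have k : x n ∈ range x := ⟨n, rfl⟩
    simp only [h, dif_pos k]
    rw [hx.injective k.choose_spec]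
  have hxt : ∀ z, z ∉ range x → h z = ⊥ := fun z hz => by simp only [h, dif_neg hz]
  let Z := closure (range x)
  have hle : ∀ z ∈ Z, ∀ w ∈ Z, z ≤ w → h z ≤ h w := by
    intro z hz w hw hzw
    by_cases kz : z ∈ range x
    · by_cases kw : w ∈ range x
      · obtain ⟨n, rfl⟩ := kz
        obtain ⟨m, rfl⟩ := kw
        rw [hxn, hxn]; exact heanti (hx.le_iff_ge.1 hzw)
      · obtain ⟨m, rfl⟩ := kz
        have := desc_closure hc hx hw kw (m + 1)
        exact absurd (hzw.trans this) (hx (Nat.lt_succ_self m)).not_ge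
    · rw [hxt z kz]; exact bot_le
  have htot : ∀ z ∈ Z, ∀ w ∈ Z, z ≤ w ∨ w ≤ z := by
    intro z hz w hw
    by_cases kz : z ∈ range x
    · obtain ⟨n, rfl⟩ := kz
      by_cases kw : w ∈ range x
      · obtain ⟨m, rfl⟩ := kw
        exact (le_total m n).imp (fun k => hx.antitone k) (fun k => hx.antitone k)
      · exact Or.inr (desc_closure hc hx hw kw n)
    · by_cases kw : w ∈ range x
      · obtain ⟨m, rfl⟩ := kw
        exact Or.inl (desc_closure hc hx hz kz m)
      · exact Or.inl (desc_unique hc hx hz kz hw kw).le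
  have hinj : InjOn h Z := by
    intro z hz w hw hzw
    by_cases kz : z ∈ range x
    · obtain ⟨n, rfl⟩ := kz
      by_cases kw : w ∈ range x
      · obtain ⟨m, rfl⟩ := kw
        rw [hxn, hxn] at hzw; rw [he hzw]
      · rw [hxn, hxt w kw] at hzw; exact absurd hzw (heb n)
    · by_cases kw : w ∈ range x
      · obtain ⟨m, rfl⟩ := kw
        rw [hxn, hxt z kz] at hzw; exact absurd hzw.symm (heb m)
      · exact desc_unique hc hx hz kz hw kw
  have hcl := H Z isClosed_closure
    (by
      intro a ha b hb
      rcases htot a ha b hb with k | k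
      · rwa [inf_eq_left.2 k]
      · rwa [inf_eq_right.2 k]) L hcont h
    (by
      rw [continuousOn_iff_continuous_domRestrict]
      refine continuous_iff_isClosed.2 fun s hsc => ?_
      rcases (hclosed s).1 hsc with rfl | k
      · simp
      · exact (k.preimage (injOn_iff_injective.1 hinj).injOn).isClosed)
    (by
      intro a ha b hb
      rcases htot a ha b hb with k | k
      · rw [inf_eq_left.2 k, inf_eq_left.2 (hle a ha b hb k)]
      · rw [inf_eq_right.2 k, inf_eq_right.2 (hle b hb a ha k)])
  rcases (hclosed _).1 hcl with k | k
  · obtain ⟨z, hz, hzp⟩ : p ∈ h '' Z := k ▸ mem_univ p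
    by_cases k : z ∈ range x
    · obtain ⟨n, rfl⟩ := k
      rw [hxn] at hzp; exact hep n hzp
    · rw [hxt z k] at hzp; exact hp hzp.symm
  · refine infinite_range_of_injective he (k.subset ?_)
    rintro _ ⟨n, rfl⟩
    exact ⟨x n, subset_closure ⟨n, rfl⟩, hxn n⟩

lemma backward_dir (hc : Continuous fun p : X × X => p.1 ⊓ p.2) (H : ClosedImages X) :
    ChainFinite X := by
  intro C hC
  by_contra hinf
  have hinf : C.Infinite := hinf
  let f : ℕ → X := fun n => hinf.natEmbedding C n
  have hf : Function.Injective f :=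
    Subtype.val_injective.comp (hinf.natEmbedding C).injective
  have hfC : ∀ n, f n ∈ C := fun n => (hinf.natEmbedding C n).2
  obtain ⟨g, hg | hg⟩ := exists_increasing_or_nonincreasing_subseq (· < ·) f
  · refine no_asc hc H (x := f ∘ g) (fun m n k => hg m n k) (ULift.{u} (WithTop (WithTop ℕ)))
      (fun n => ⟨((n : WithTop ℕ) : WithTop (WithTop ℕ))⟩) ?_ ⟨((⊤ : WithTop ℕ) : WithTop (WithTop ℕ))⟩ ⟨⊤⟩ ?_ ?_ ?_
    · intro m n k
      exact ULift.down_lt.1 (WithTop.coe_lt_coe.2 (WithTop.coe_lt_coe.2 k))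
    · intro n
      exact ULift.down_lt.1 (WithTop.coe_lt_coe.2 (WithTop.coe_lt_top n))
    · exact ULift.down_lt.1 (WithTop.coe_lt_top _)
    · rintro ⟨c⟩
      induction c using WithTop.recTopCoe with
      | top => exact Or.inr (Or.inl rfl)
      | coe c =>
        induction c using WithTop.recTopCoe with
        | top => exact Or.inl rfl
        | coe c => exact Or.inr (Or.inr ⟨c, rfl⟩)
  · refine no_desc hc H (x := f ∘ g) (fun m n k => ?_) (ULift.{u} (WithBot (ℕᵒᵈ × Bool)))
      (fun n => ⟨((OrderDual.toDual n, true) : ℕᵒᵈ × Bool)⟩) ?_ ?_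
      ⟨((OrderDual.toDual 0, false) : ℕᵒᵈ × Bool)⟩ ?_ ?_ ?_ ?_ ?_
    · have hne : f (g n) ≠ f (g m) := fun h => k.ne' (g.injective (hf h))
      rcases hC (hfC (g n)) (hfC (g m)) hne with q | q
      · exact lt_of_le_of_ne q hne
      · exact absurd (lt_of_le_of_ne q hne.symm) (hg m n k)
    · intro m n k
      simpa using k
    · intro m n k
      exact ULift.down_le.1 (WithBot.coe_le_coe.2 ⟨k, le_rfl⟩)
    · intro n k
      simp at k
    · intro k
      have := congrArg ULift.down k
      exact WithBot.coe_ne_bot this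
    · intro n k
      have := congrArg ULift.down k
      exact WithBot.coe_ne_bot this
    · rintro ⟨a⟩ ⟨b⟩ k
      have k' : a ⊓ b = ⊥ := congrArg ULift.down k
      induction a using WithBot.recBotCoe with
      | bot => exact Or.inl rfl
      | coe a =>
        induction b using WithBot.recBotCoe with
        | bot => exact Or.inr rfl
        | coe b =>
          rw [← WithBot.coe_inf] at k'
          exact absurd k' WithBot.coe_ne_bot
    · rintro ⟨c⟩ hcb
      induction c using WithBot.recBotCoe with
      | bot => exact absurd rfl hcb
      | coe c =>
        obtain ⟨n, b⟩ := c
        have hF : ((Iic (OrderDual.ofDual n)) ×ˢ (univ : Set Bool)).Finite :=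
          (finite_Iic _).prod finite_univ
        refine (hF.image (fun q : ℕ × Bool =>
          (⟨((OrderDual.toDual q.1, q.2) : ℕᵒᵈ × Bool)⟩ : ULift.{u} (WithBot (ℕᵒᵈ × Bool))))).subset ?_
        rintro ⟨d⟩ hd
        have hd' : (((n, b) : ℕᵒᵈ × Bool) : WithBot (ℕᵒᵈ × Bool)) ≤ d := hd
        induction d using WithBot.recBotCoe with
        | bot => exact absurd (le_bot_iff.1 hd') WithBot.coe_ne_bot
        | coe d =>
          have hd2 := WithBot.coe_le_coe.1 hd'
          exact ⟨(OrderDual.ofDual d.1, d.2), ⟨hd2.1, mem_univ _⟩, rfl⟩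

end orders

/-- A Hausdorff topological semilattice `X` is chain-finite if and only if for every
closed subsemilattice `Z ⊆ X` and every continuous semilattice homomorphism `h : Z → Y`
into a `T₁` topological semilattice `Y`, the image `h(Z)` is closed in `Y`. -/
theorem stmt11 {X : Type u} [SemilatticeInf X] [TopologicalSpace X] [T2Space X]
    (hXcont : Continuous fun p : X × X => p.1 ⊓ p.2) :
    ChainFinite X ↔
      ∀ Z : Set X, IsClosed Z → (∀ a ∈ Z, ∀ b ∈ Z, a ⊓ b ∈ Z) →
        ∀ (Y : Type u) [SemilatticeInf Y] [TopologicalSpace Y] [T1Space Y],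
          (Continuous fun p : Y × Y => p.1 ⊓ p.2) →
          ∀ h : X → Y, ContinuousOn h Z →
            (∀ a ∈ Z, ∀ b ∈ Z, h (a ⊓ b) = h a ⊓ h b) →
            IsClosed (h '' Z) := by
  constructor
  · intro hX Z _ hZ Y _ _ _ hc h _ hh
    exact forward_dir hX Z hZ hc h hh
  · intro H
    exact backward_dir hXcont H
end
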